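/- arXiv:2011.00889 — 2 statements merged into one kernel-verified Lean document; each statement's English description precedes it below -/
import Mathlib

section
/- Let K ≥ 2 and let W₁,…,W_K, Y₁,…,Y_{K−1}, Y_{K,D}, Y_{K,P}, S be random variables on a common probability space taking values in finite measurable types, let Y_K denote the pair (Y_{K,D}, Y_{K,P}), and let ε ≥ 0. Assume: (i) H(W_i | (Y_i, S)) ≤ ε for every i ∈ {1,…,K}; (ii) I(W_i ; (Y₁,…,Y_{i−1}) | S) ≤ ε for every i ∈ {2,…,K}; (iii) I(W_K ; W₁ | S) = 0; (iv) H(Y_{K,D} | (Y₁,…,Y_{K−1}, W₁, S)) ≤ H(Y₁ | (W₁, S)). Then Σ_{i=1}^{K} H(W_i | S) ≤ Σ_{i=1}^{K−1} H(Y_i | S) + H(Y_{K,P} | S) + 2Kε. -/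
open MeasureTheory

namespace Paper

variable {Ω : Type*} [MeasurableSpace Ω]

/-- Shannon entropy of a finitely-valued random variable. -/
noncomputable def entH {S : Type*} [Fintype S] [MeasurableSpace S]
    (μ : Measure Ω) (X : Ω → S) : ℝ :=
  ∑ s : S, Real.negMulLog ((μ.map X) {s}).toReal

/-- Conditional Shannon entropy `H(X | Y)`. -/
noncomputable def condH {S T : Type*} [Fintype S] [MeasurableSpace S]
    [Fintype T] [MeasurableSpace T] (μ : Measure Ω) (X : Ω → S) (Y : Ω → T) : ℝ :=
  entH μ (fun ω => (X ω, Y ω)) - entH μ Y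

/-- Mutual information `I(X ; Y)`. -/
noncomputable def mutI {S T : Type*} [Fintype S] [MeasurableSpace S]
    [Fintype T] [MeasurableSpace T] (μ : Measure Ω) (X : Ω → S) (Y : Ω → T) : ℝ :=
  entH μ X + entH μ Y - entH μ (fun ω => (X ω, Y ω))

/-- Conditional mutual information `I(X ; Y | Z)`. -/
noncomputable def condI {S T U : Type*} [Fintype S] [MeasurableSpace S]
    [Fintype T] [MeasurableSpace T] [Fintype U] [MeasurableSpace U]
    (μ : Measure Ω) (X : Ω → S) (Y : Ω → T) (Z : Ω → U) : ℝ :=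
  condH μ X Z + condH μ Y Z - condH μ (fun ω => (X ω, Y ω)) Z

/-- The tuple `(Y 0, …, Y (m-1))` of the first `m` random variables of a family `Y`. -/
def preY {Ω : Type*} {n : ℕ} {β : Fin n → Type*} (Y : ∀ i, Ω → β i) (m : ℕ) (hm : m ≤ n)
    (ω : Ω) : ∀ s : Fin m, β (Fin.castLE hm s) :=
  fun s => Y (Fin.castLE hm s) ω

/-- Probabilities of events determined by `Z` are sums of point probabilities of `Z`. -/
lemma real_preimage_eq_sum {A B : Type*} [Fintype A] [MeasurableSpace A]
    [MeasurableSingletonClass A] {μ : Measure Ω} [IsProbabilityMeasure μ]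
    {Z : Ω → A} (hZ : Measurable Z)
    (g : A → B) (b : B) [DecidableEq B] :
    μ.real ((fun ω => g (Z ω)) ⁻¹' {b}) = ∑ a with g a = b, μ.real (Z ⁻¹' {a}) := by
  have h : (fun ω => g (Z ω)) ⁻¹' {b} = Z ⁻¹' ↑({a | g a = b} : Finset A) := by
    ext ω; simp
  rw [h, sum_measureReal_preimage_singleton _ fun a _ => hZ (measurableSet_singleton a)]

section Entropy

variable {A B C D : Type*}
  [Fintype A] [MeasurableSpace A] [MeasurableSingletonClass A]
  [Fintype B] [MeasurableSpace B] [MeasurableSingletonClass B]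
  [Fintype C] [MeasurableSpace C] [MeasurableSingletonClass C]
  [Fintype D] [MeasurableSpace D] [MeasurableSingletonClass D]
  {μ : Measure Ω} [IsProbabilityMeasure μ]

/-- The entropy of a function of `Z` as an expectation over the law of `Z`. -/
lemma entH_comp {Z : Ω → A} (hZ : Measurable Z) (g : A → B) :
    entH μ (fun ω => g (Z ω)) =
      -∑ a, μ.real (Z ⁻¹' {a}) * Real.log (μ.real ((fun ω => g (Z ω)) ⁻¹' {g a})) := by
  classical
  have hg : Measurable fun ω => g (Z ω) := (measurable_of_finite g).comp hZ
  rw [entH, ← Finset.sum_fiberwise (s := Finset.univ) (g := g), ← Finset.sum_neg_distrib]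
  refine Finset.sum_congr rfl fun b _ => ?_
  rw [Measure.map_apply hg (measurableSet_singleton b), ← Measure.real, Real.negMulLog, neg_mul]
  conv_lhs => rw [real_preimage_eq_sum hZ g b, Finset.sum_mul]
  congr 1
  refine Finset.sum_congr rfl fun a ha => ?_
  rw [(Finset.mem_filter.mp ha).2, real_preimage_eq_sum hZ g b]

/-- Data processing: a function of `Z` has at most the entropy of `Z`. -/
lemma entH_comp_le {Z : Ω → A} (hZ : Measurable Z) (g : A → B) :
    entH μ (fun ω => g (Z ω)) ≤ entH μ Z := by
  have hid := entH_comp (μ := μ) hZ id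
  simp only [id] at hid
  rw [entH_comp hZ g, hid]
  refine neg_le_neg (Finset.sum_le_sum fun a _ => ?_)
  rcases (measureReal_nonneg (μ := μ) (s := Z ⁻¹' {a})).eq_or_lt with h | h
  · simp [← h]
  · refine mul_le_mul_of_nonneg_left (Real.log_le_log h (measureReal_mono ?_)) h.le
    intro ω hω
    simp_all

/-- Entropy is invariant under bijections. -/
lemma entH_congr {X : Ω → A} {Z : Ω → B} (hX : Measurable X) (hZ : Measurable Z)
    (f : A → B) (g : B → A) (hf : ∀ ω, Z ω = f (X ω)) (hg : ∀ ω, X ω = g (Z ω)) :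
    entH μ X = entH μ Z := by
  apply le_antisymm
  · rw [funext hg]; exact entH_comp_le hZ g
  · rw [funext hf]; exact entH_comp_le hX f

/-- Submodularity of entropy. -/
lemma entH_submodular {X : Ω → A} {Y : Ω → B} {Z : Ω → C}
    (hX : Measurable X) (hY : Measurable Y) (hZ : Measurable Z) :
    entH μ (fun ω => (X ω, Y ω, Z ω)) + entH μ Z ≤
      entH μ (fun ω => (X ω, Z ω)) + entH μ (fun ω => (Y ω, Z ω)) := by
  classical
  have hT : Measurable fun ω => (X ω, Y ω, Z ω) := hX.prodMk (hY.prodMk hZ)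
  have e0 := entH_comp (μ := μ) hT id
  have e1 := entH_comp (μ := μ) hT fun t => (t.1, t.2.2)
  have e2 := entH_comp (μ := μ) hT fun t => (t.2.1, t.2.2)
  have e3 := entH_comp (μ := μ) hT fun t => t.2.2
  simp only [id] at e0
  simp only at e1 e2 e3
  set p : A × B × C → ℝ := fun t => μ.real ((fun ω => (X ω, Y ω, Z ω)) ⁻¹' {t}) with hp
  set a : A × C → ℝ := fun t => μ.real ((fun ω => (X ω, Z ω)) ⁻¹' {t}) with ha
  set b : B × C → ℝ := fun t => μ.real ((fun ω => (Y ω, Z ω)) ⁻¹' {t}) with hb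
  set c : C → ℝ := fun t => μ.real (Z ⁻¹' {t}) with hc
  have key : ∀ t : A × B × C,
      p t * Real.log (a (t.1, t.2.2)) + p t * Real.log (b (t.2.1, t.2.2))
        - p t * Real.log (p t) - p t * Real.log (c t.2.2)
      ≤ a (t.1, t.2.2) * b (t.2.1, t.2.2) / c t.2.2 - p t := by
    rintro ⟨x, y, z⟩
    have p0 : 0 ≤ p (x, y, z) := measureReal_nonneg
    have a0 : 0 ≤ a (x, z) := measureReal_nonneg
    have b0 : 0 ≤ b (y, z) := measureReal_nonneg
    have c0 : 0 ≤ c z := measureReal_nonneg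
    rcases p0.eq_or_lt with h | h
    · simp only [← h, zero_mul, add_zero, sub_zero]
      positivity
    · have pa : p (x, y, z) ≤ a (x, z) := measureReal_mono fun ω hω => by simp_all
      have pb : p (x, y, z) ≤ b (y, z) := measureReal_mono fun ω hω => by simp_all
      have pc : p (x, y, z) ≤ c z := measureReal_mono fun ω hω => by simp_all
      have a1 := h.trans_le pa
      have b1 := h.trans_le pb
      have c1 := h.trans_le pc
      have hl := Real.log_le_sub_one_of_pos
        (show 0 < a (x, z) * b (y, z) / (p (x, y, z) * c z) by positivity)
      rw [Real.log_div (by positivity) (by positivity), Real.log_mul a1.ne' b1.ne',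
        Real.log_mul h.ne' c1.ne'] at hl
      have hm := mul_le_mul_of_nonneg_left hl h.le
      have hr : p (x, y, z) * (a (x, z) * b (y, z) / (p (x, y, z) * c z) - 1)
          = a (x, z) * b (y, z) / c z - p (x, y, z) := by
        field_simp
      rw [hr] at hm
      dsimp only
      linarith
  have sa : ∀ z, ∑ x, a (x, z) = c z := fun z => by
    have h := real_preimage_eq_sum (μ := μ) (hX.prodMk hZ) Prod.snd z
    change c z = ∑ t with t.2 = z, a t at h
    rw [h, Finset.sum_filter, Fintype.sum_prod_type]
    simp
  have sb : ∀ z, ∑ y, b (y, z) = c z := fun z => by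
    have h := real_preimage_eq_sum (μ := μ) (hY.prodMk hZ) Prod.snd z
    change c z = ∑ t with t.2 = z, b t at h
    rw [h, Finset.sum_filter, Fintype.sum_prod_type]
    simp
  have sp : ∑ t, p t = ∑ z, c z := by
    rw [← Finset.sum_fiberwise (s := Finset.univ) (g := fun t : A × B × C => t.2.2)]
    exact Finset.sum_congr rfl fun z _ =>
      (real_preimage_eq_sum (μ := μ) hT (fun t => t.2.2) z).symm
  have sq : ∑ t : A × B × C, a (t.1, t.2.2) * b (t.2.1, t.2.2) / c t.2.2 = ∑ z, c z := by
    simp only [Fintype.sum_prod_type]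
    simp_rw [Finset.sum_comm (γ := B) (α := C)]
    rw [Finset.sum_comm]
    refine Finset.sum_congr rfl fun z _ => ?_
    simp_rw [← Finset.sum_div, ← Finset.mul_sum]
    rw [← Finset.sum_mul, sa, sb, mul_self_div_self]
  have hs := Finset.sum_le_sum fun t (_ : t ∈ Finset.univ) => key t
  simp only [Finset.sum_sub_distrib, Finset.sum_add_distrib] at hs
  rw [e0, e1, e2, e3]
  linarith

/-- Conditioning reduces entropy. -/
lemma condH_prod_le {X : Ω → A} {P : Ω → B} {S : Ω → C}
    (hX : Measurable X) (hP : Measurable P) (hS : Measurable S) :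
    condH μ X (fun ω => (P ω, S ω)) ≤ condH μ X S := by
  have h := entH_submodular (μ := μ) hX hP hS
  unfold condH
  linarith

/-- Conditional entropy does not increase when a variable is discarded. -/
lemma condH_comp_le {X : Ω → A} {S : Ω → C} (hX : Measurable X) (hS : Measurable S)
    (g : A → B) : condH μ (fun ω => g (X ω)) S ≤ condH μ X S :=
  sub_le_sub_right (entH_comp_le (hX.prodMk hS) fun t => (g t.1, t.2)) _

/-- Chain rule for conditional entropy. -/
lemma condH_prod {X : Ω → A} {Y : Ω → B} {S : Ω → C}
    (hX : Measurable X) (hY : Measurable Y) (hS : Measurable S) :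
    condH μ (fun ω => (X ω, Y ω)) S = condH μ X (fun ω => (Y ω, S ω)) + condH μ Y S := by
  have h : entH μ (fun ω => ((X ω, Y ω), S ω)) = entH μ (fun ω => (X ω, Y ω, S ω)) :=
    entH_congr ((hX.prodMk hY).prodMk hS) (hX.prodMk (hY.prodMk hS))
      (fun t => (t.1.1, t.1.2, t.2)) (fun t => ((t.1, t.2.1), t.2.2)) (fun _ => rfl) fun _ => rfl
  unfold condH
  rw [h]
  ring

/-- Symmetry of the joint conditional entropy. -/
lemma condH_prod_comm {X : Ω → A} {Y : Ω → B} {S : Ω → C}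
    (hX : Measurable X) (hY : Measurable Y) (hS : Measurable S) :
    condH μ (fun ω => (X ω, Y ω)) S = condH μ (fun ω => (Y ω, X ω)) S :=
  le_antisymm (condH_comp_le (hY.prodMk hX) hS Prod.swap)
    (condH_comp_le (hX.prodMk hY) hS Prod.swap)

/-- Conditional entropy is invariant under exchanging two conditioning variables. -/
lemma condH_cond_swap {X : Ω → A} {P : Ω → B} {Q : Ω → C} {S : Ω → D}
    (hX : Measurable X) (hP : Measurable P) (hQ : Measurable Q) (hS : Measurable S) :
    condH μ X (fun ω => (P ω, Q ω, S ω)) = condH μ X (fun ω => (Q ω, P ω, S ω)) := by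
  have hPQ := hP.prodMk (hQ.prodMk hS)
  have hQP := hQ.prodMk (hP.prodMk hS)
  exact congrArg₂ (· - ·)
    (entH_congr (hX.prodMk hPQ) (hX.prodMk hQP)
      (fun t => (t.1, t.2.2.1, t.2.1, t.2.2.2)) (fun t => (t.1, t.2.2.1, t.2.1, t.2.2.2))
      (fun _ => rfl) fun _ => rfl)
    (entH_congr hPQ hQP
      (fun t => (t.2.1, t.1, t.2.2)) (fun t => (t.2.1, t.1, t.2.2)) (fun _ => rfl) fun _ => rfl)

/-- Removing `W` from the conditioning costs at most the entropy of `W` given the rest. -/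
lemma condH_le_condH_add {X : Ω → A} {W : Ω → B} {S : Ω → C}
    (hX : Measurable X) (hW : Measurable W) (hS : Measurable S) :
    condH μ X S ≤ condH μ X (fun ω => (W ω, S ω)) + condH μ W S := by
  rw [← condH_prod hX hW hS]
  exact condH_comp_le (hX.prodMk hW) hS Prod.fst

/-- A message `W` decodable from `Y` and nearly independent of `P` has entropy at most that of `Y`
given `P`, up to the two errors. -/
lemma condH_le_of_decodable_of_secret {W : Ω → A} {Y : Ω → B} {P : Ω → C} {S : Ω → D} {ε : ℝ}
    (hW : Measurable W) (hY : Measurable Y) (hP : Measurable P) (hS : Measurable S)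
    (hdec : condH μ W (fun ω => (Y ω, S ω)) ≤ ε) (hsec : condI μ W P S ≤ ε) :
    condH μ W S ≤ condH μ Y (fun ω => (P ω, S ω)) + 2 * ε := by
  have h1 := condH_prod (μ := μ) hW hP hS
  have h2 := condH_le_condH_add (μ := μ) hW hY (hP.prodMk hS)
  have h3 := condH_prod_le (μ := μ) hW hP (hY.prodMk hS)
  rw [condH_cond_swap hW hP hY hS] at h3
  unfold condI at hsec
  linarith

end Entropy

/-- Summation of termwise bounds in which the first and last terms share a cancelling term `d`. -/
lemma sum_le_sum_of_boundary_le {n : ℕ} (w : Fin (n + 2) → ℝ) (y : Fin (n + 1) → ℝ) {d p ε : ℝ}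
    (hfirst : w 0 + d ≤ y 0 + ε) (hmid : ∀ i : Fin n, w i.succ.castSucc ≤ y i.succ + 2 * ε)
    (hlast : w (Fin.last (n + 1)) ≤ d + p + 3 * ε) :
    ∑ i, w i ≤ ∑ i, y i + p + 2 * (n + 2 : ℕ) * ε := by
  have hsum := Finset.sum_le_sum fun i (_ : i ∈ Finset.univ) => hmid i
  rw [Finset.sum_add_distrib, Finset.sum_const, Finset.card_univ, Fintype.card_fin,
    nsmul_eq_mul] at hsum
  rw [Fin.sum_univ_castSucc, Fin.sum_univ_succ, Fin.sum_univ_succ y, Fin.castSucc_zero]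
  push_cast
  linarith

/-- Entropic core of the K-user converse ((cvp6)–(cvp8)).  User `i ∈ {1,…,K}` of the paper is
index `i-1`; `Y ⟨0,_⟩,…,Y ⟨K-2,_⟩` are the outputs of receivers `1,…,K-1`, while receiver
`K`'s output is the pair `(YKD, YKP)` of its delayed- and perfect-CSIT halves. -/
theorem stmt_8 {Ω : Type*} [MeasurableSpace Ω] (μ : Measure Ω) [IsProbabilityMeasure μ]
    {K : ℕ} (hK : 2 ≤ K) {α : Fin K → Type*} {β : Fin (K - 1) → Type*} {δD δP σ : Type*}
    [∀ i, Fintype (α i)] [∀ i, Nonempty (α i)]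
    [∀ i, MeasurableSpace (α i)] [∀ i, MeasurableSingletonClass (α i)]
    [∀ i, Fintype (β i)] [∀ i, Nonempty (β i)]
    [∀ i, MeasurableSpace (β i)] [∀ i, MeasurableSingletonClass (β i)]
    [Fintype δD] [Nonempty δD] [MeasurableSpace δD] [MeasurableSingletonClass δD]
    [Fintype δP] [Nonempty δP] [MeasurableSpace δP] [MeasurableSingletonClass δP]
    [Fintype σ] [Nonempty σ] [MeasurableSpace σ] [MeasurableSingletonClass σ]
    (W : ∀ i, Ω → α i) (Y : ∀ i, Ω → β i) (YKD : Ω → δD) (YKP : Ω → δP) (S : Ω → σ)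
    (hW : ∀ i, Measurable (W i)) (hY : ∀ i, Measurable (Y i))
    (hYKD : Measurable YKD) (hYKP : Measurable YKP) (hS : Measurable S)
    {ε : ℝ} (hε : 0 ≤ ε)
    (hfano : ∀ i : Fin (K - 1),
      condH μ (W (Fin.castLE (by omega) i)) (fun ω => (Y i ω, S ω)) ≤ ε)
    (hfanoK : condH μ (W ⟨K - 1, by omega⟩) (fun ω => ((YKD ω, YKP ω), S ω)) ≤ ε)
    (hsec : ∀ i : Fin K, i ≠ ⟨0, by omega⟩ →
      condI μ (W i) (fun ω => preY Y i.val (Nat.le_pred_of_lt i.isLt) ω) S ≤ ε)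
    (hindep : condI μ (W ⟨K - 1, by omega⟩) (W ⟨0, by omega⟩) S = 0)
    (hsep : condH μ YKD
        (fun ω => ((fun i : Fin (K - 1) => Y i ω), W ⟨0, by omega⟩ ω, S ω)) ≤
      condH μ (Y ⟨0, by omega⟩) (fun ω => (W ⟨0, by omega⟩ ω, S ω))) :
    ∑ i : Fin K, condH μ (W i) S ≤
      (∑ i : Fin (K - 1), condH μ (Y i) S) + condH μ YKP S + 2 * K * ε := by
  obtain ⟨n, rfl⟩ : ∃ n, K = n + 2 := ⟨K - 2, by omega⟩
  have hpre (m : ℕ) (hm : m ≤ n + 2 - 1) : Measurable (preY Y m hm) :=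
    measurable_pi_lambda _ fun s => hY _
  have hYall : Measurable fun ω => (fun i : Fin (n + 2 - 1) => Y i ω) := measurable_pi_lambda _ hY
  have hfirst : condH μ (W 0) S + condH μ (Y (0 : Fin (n + 1))) (fun ω => (W 0 ω, S ω)) ≤
      condH μ (Y (0 : Fin (n + 1))) S + ε := by
    have h0 : condH μ (W 0) (fun ω => (Y (0 : Fin (n + 1)) ω, S ω)) ≤ ε := hfano (0 : Fin (n + 1))
    have h1 := condH_prod (μ := μ) (hW 0) (hY (0 : Fin (n + 1))) hS
    have h2 := condH_prod (μ := μ) (hY (0 : Fin (n + 1))) (hW 0) hS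
    have h3 := condH_prod_comm (μ := μ) (hW 0) (hY (0 : Fin (n + 1))) hS
    linarith
  have hmid (i : Fin n) :
      condH μ (W i.succ.castSucc) S ≤ condH μ (Y (i.succ : Fin (n + 1))) S + 2 * ε :=
    (condH_le_of_decodable_of_secret (hW _) (hY (i.succ : Fin (n + 1))) (hpre _ _) hS
      (hfano (i.succ : Fin (n + 1)))
      (hsec i.succ.castSucc (by simp [Fin.ext_iff]))).trans
      (add_le_add_left (condH_prod_le (hY _) (hpre _ _) hS) _)
  have hlast : condH μ (W (Fin.last (n + 1))) S ≤
      condH μ (Y (0 : Fin (n + 1))) (fun ω => (W 0 ω, S ω)) + condH μ YKP S + 3 * ε := by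
    have hW0 : condH μ (W 0) (fun ω => ((fun i : Fin (n + 2 - 1) => Y i ω), S ω)) ≤ ε := by
      refine le_trans ?_ (hfano (0 : Fin (n + 1)))
      have hle := condH_prod_le (μ := μ) (hW 0) hYall ((hY (0 : Fin (n + 1))).prodMk hS)
      refine le_trans (le_of_eq ?_) hle
      exact congrArg₂ (· - ·)
        (entH_congr ((hW 0).prodMk (hYall.prodMk hS))
          ((hW 0).prodMk (hYall.prodMk ((hY (0 : Fin (n + 1))).prodMk hS)))
          (fun t => (t.1, t.2.1, t.2.1 (0 : Fin (n + 1)), t.2.2))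
          (fun t => (t.1, t.2.1, t.2.2.2)) (fun _ => rfl) fun _ => rfl)
        (entH_congr (hYall.prodMk hS) (hYall.prodMk ((hY (0 : Fin (n + 1))).prodMk hS))
          (fun t => (t.1, t.1 (0 : Fin (n + 1)), t.2))
          (fun t => (t.1, t.2.2)) (fun _ => rfl) fun _ => rfl)
    have h1 : condH μ (W (Fin.last (n + 1))) S ≤
        condH μ (fun ω => (YKD ω, YKP ω)) (fun ω => ((fun i : Fin (n + 2 - 1) => Y i ω), S ω))
          + 2 * ε :=
      condH_le_of_decodable_of_secret (hW _) (hYKD.prodMk hYKP) hYall hS hfanoK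
        (hsec (Fin.last (n + 1)) (by simp [Fin.ext_iff]))
    rw [condH_prod hYKD hYKP (hYall.prodMk hS)] at h1
    have h2 := condH_prod_le (μ := μ) hYKD hYKP (hYall.prodMk hS)
    have h3 := condH_prod_le (μ := μ) hYKP hYall hS
    have h4 := condH_le_condH_add (μ := μ) hYKD (hW 0) (hYall.prodMk hS)
    rw [condH_cond_swap hYKD (hW 0) hYall hS] at h4
    have h5 : condH μ YKD (fun ω => ((fun i : Fin (n + 2 - 1) => Y i ω), W 0 ω, S ω)) ≤
      condH μ (Y (0 : Fin (n + 1))) (fun ω => (W 0 ω, S ω)) := hsep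
    linarith
  exact sum_le_sum_of_boundary_le (fun i => condH μ (W i) S) (fun i => condH μ (Y i) S)
    hfirst hmid hlast

end Paper
end

section
/- Let W₁, W₂, W₃, Y₁, Y₂, Y₃, S be random variables on a common probability space taking values in finite measurable types, and let ε ≥ 0. Assume: (i) H(W_i | (Y_i, S)) ≤ ε for i = 1, 2, 3; (ii) I(W₂ ; Y₁ | S) ≤ ε; (iii) I(W₃ ; (Y₁, Y₂) | S) ≤ ε; (iv) I(W₃ ; W₁ | S) = 0. Then H(W₁ | S) + H(W₂ | S) + H(W₃ | S) ≤ I(W₁ ; Y₁ | S) + I(W₂ ; Y₂ | (Y₁, S)) + I(W₃ ; Y₃ | (Y₁, Y₂, W₁, S)) + 6ε. -/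
open MeasureTheory

namespace Paper

variable {Ω : Type*} [MeasurableSpace Ω]

section Entropy

theorem real_map_comp_singleton {α β : Type*} [Finite α]
    [MeasurableSpace α] [MeasurableSingletonClass α]
    [MeasurableSpace β] [MeasurableSingletonClass β]
    {μ : Measure Ω} {X : Ω → α} (hX : Measurable X) (f : α → β) (b : β) :
    (μ.map fun ω => f (X ω)).real {b} = (μ.map X).real (f ⁻¹' {b}) := by
  have hf : Measurable f := .of_discrete
  rw [← map_measureReal_apply hf (measurableSet_singleton b), Measure.map_map hf hX]
  rfl

variable {μ : Measure Ω} [IsFiniteMeasure μ]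

theorem real_map_comp_singleton_eq_sum {α β : Type*} [Fintype α]
    [MeasurableSpace α] [MeasurableSingletonClass α] [DecidableEq β]
    [MeasurableSpace β] [MeasurableSingletonClass β] {X : Ω → α} (hX : Measurable X)
    (f : α → β) (b : β) :
    (μ.map fun ω => f (X ω)).real {b} = ∑ a with f a = b, (μ.map X).real {a} := by
  rw [real_map_comp_singleton hX, sum_measureReal_singleton]
  congr 1
  ext a
  simp

theorem real_map_singleton_le {α β : Type*} [Finite α]
    [MeasurableSpace α] [MeasurableSingletonClass α]
    [MeasurableSpace β] [MeasurableSingletonClass β]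
    {X : Ω → α} (hX : Measurable X) (f : α → β) (a : α) :
    (μ.map X).real {a} ≤ (μ.map fun ω => f (X ω)).real {f a} := by
  rw [real_map_comp_singleton hX]
  exact measureReal_mono (by simp)

theorem sum_real_map_prodMk {α β : Type*} [Fintype α]
    [MeasurableSpace α] [MeasurableSingletonClass α] [Finite β]
    [MeasurableSpace β] [MeasurableSingletonClass β]
    {X : Ω → α} {Y : Ω → β} (hX : Measurable X) (hY : Measurable Y) (y : β) :
    ∑ x, (μ.map fun ω => (X ω, Y ω)).real {(x, y)} = (μ.map Y).real {y} := by
  classical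
  have := Fintype.ofFinite β
  have h : (μ.map Y).real {y} = ∑ a with Prod.snd a = y,
      (μ.map fun ω => (X ω, Y ω)).real {a} :=
    real_map_comp_singleton_eq_sum (hX.prodMk hY) Prod.snd y
  rw [h]
  refine Finset.sum_bij' (fun x _ => (x, y)) (fun a _ => a.1) ?_ ?_ ?_ ?_ ?_ <;> simp

/-- Pointwise form of the log-sum bound behind strong subadditivity of entropy. -/
theorem mul_log_sub_le {p q r t : ℝ} (hp : 0 ≤ p) (hq : p ≤ q) (hr : p ≤ r) (ht : p ≤ t) :
    p * (Real.log t + Real.log q - Real.log r - Real.log p) ≤ t * q / r - p := by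
  rcases hp.eq_or_lt with rfl | h
  · simpa using div_nonneg (mul_nonneg ht hq) hr
  · have hq := h.trans_le hq
    have hr := h.trans_le hr
    have ht := h.trans_le ht
    have hlog := mul_le_mul_of_nonneg_left (Real.log_le_sub_one_of_pos
      (x := t * q / r / p) (by positivity)) h.le
    rwa [Real.log_div (by positivity) h.ne', Real.log_div (by positivity) hr.ne',
      Real.log_mul ht.ne' hq.ne', mul_sub _ _ 1, mul_div_cancel₀ _ h.ne', mul_one] at hlog

variable {α β γ : Type*} [Fintype α] [MeasurableSpace α] [MeasurableSingletonClass α]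
  [Fintype β] [MeasurableSpace β] [MeasurableSingletonClass β]
  [Fintype γ] [MeasurableSpace γ] [MeasurableSingletonClass γ]

/-- The entropy of a function of `X`, as an expectation under the law of `X`. -/
theorem entH_comp_s9 {X : Ω → α} (hX : Measurable X) (f : α → β) :
    entH μ (fun ω => f (X ω)) =
      ∑ a, -((μ.map X).real {a} * Real.log ((μ.map fun ω => f (X ω)).real {f a})) := by
  classical
  rw [← Finset.sum_fiberwise Finset.univ f]
  refine Finset.sum_congr rfl fun b _ => ?_
  change Real.negMulLog ((μ.map fun ω => f (X ω)).real {b}) = _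
  calc _ = ∑ a with f a = b,
        -((μ.map X).real {a} * Real.log ((μ.map fun ω => f (X ω)).real {b})) := by
        rw [Finset.sum_neg_distrib, ← Finset.sum_mul, ← real_map_comp_singleton_eq_sum hX f,
          Real.negMulLog, neg_mul]
    _ = _ := Finset.sum_congr rfl fun a ha => by rw [(Finset.mem_filter.1 ha).2]

theorem entH_comp_le_s9 {X : Ω → α} (hX : Measurable X) (f : α → β) :
    entH μ (fun ω => f (X ω)) ≤ entH μ X := by
  have hid : entH μ X = ∑ a, -((μ.map X).real {a} * Real.log ((μ.map X).real {a})) :=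
    entH_comp_s9 hX id
  rw [entH_comp_s9 hX f, hid]
  refine Finset.sum_le_sum fun a _ => neg_le_neg ?_
  rcases (measureReal_nonneg (μ := μ.map X) (s := {a})).eq_or_lt with h | h
  · simp [← h]
  · exact mul_le_mul_of_nonneg_left (Real.log_le_log h (real_map_singleton_le hX f a)) h.le

/-- Conditioning on more information does not increase entropy. -/
theorem condH_le_condH_comp {X : Ω → α} {Z : Ω → β} (hX : Measurable X) (hZ : Measurable Z)
    (f : β → γ) : condH μ X Z ≤ condH μ X (fun ω => f (Z ω)) := by
  have hXZ := hX.prodMk hZ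
  have e₁ := entH_comp_s9 (μ := μ) hXZ id
  have e₂ := entH_comp_s9 (μ := μ) hXZ Prod.snd
  have e₃ := entH_comp_s9 (μ := μ) hXZ fun a => f a.2
  have e₄ := entH_comp_s9 (μ := μ) hXZ fun a => (a.1, f a.2)
  have m₂ := real_map_singleton_le (μ := μ) hXZ Prod.snd
  have m₃ := real_map_singleton_le (μ := μ) hXZ fun a => f a.2
  have m₄ := real_map_singleton_le (μ := μ) hXZ fun a => (a.1, f a.2)
  have hfZ : Measurable fun ω => f (Z ω) := Measurable.of_discrete.comp hZ
  have marg := sum_real_map_prodMk (μ := μ) hX hfZ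
  have margZ := sum_real_map_prodMk (μ := μ) hX hZ
  simp only [id] at e₁ e₂ e₃ e₄ m₂ m₃ m₄
  set p := (μ.map fun ω => (X ω, Z ω)).real
  set q := (μ.map Z).real
  set r := (μ.map fun ω => f (Z ω)).real
  set t := (μ.map fun ω => (X ω, f (Z ω))).real
  have hpt : ∀ a : α × β, -(p {a} * Real.log (p {a})) - -(p {a} * Real.log (q {a.2})) -
      (-(p {a} * Real.log (t {(a.1, f a.2)})) - -(p {a} * Real.log (r {f a.2}))) ≤
      t {(a.1, f a.2)} * q {a.2} / r {f a.2} - p {a} := fun a => by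
    have h := mul_log_sub_le (p := p {a}) measureReal_nonneg (m₂ a) (m₃ a) (m₄ a)
    linarith
  have hsum := Finset.sum_le_sum fun a (_ : a ∈ Finset.univ) => hpt a
  have hle : ∑ a : α × β, t {(a.1, f a.2)} * q {a.2} / r {f a.2} ≤ ∑ a, p {a} := by
    rw [Fintype.sum_prod_type_right, Fintype.sum_prod_type_right]
    refine Finset.sum_le_sum fun z _ => ?_
    dsimp only
    rw [margZ, ← Finset.sum_div, ← Finset.sum_mul, marg, mul_div_right_comm]
    exact mul_le_of_le_one_left measureReal_nonneg (div_self_le_one _)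
  simp only [Finset.sum_sub_distrib] at hsum
  rw [← e₁, ← e₂, ← e₃, ← e₄] at hsum
  simp only [condH]
  linarith

theorem condI_eq_condH_sub {X : Ω → α} {Y : Ω → β} {Z : Ω → γ}
    (hX : Measurable X) (hY : Measurable Y) (hZ : Measurable Z) :
    condI μ X Y Z = condH μ X Z - condH μ X (fun ω => (Y ω, Z ω)) := by
  have h₁ := entH_comp_le_s9 (μ := μ) ((hX.prodMk hY).prodMk hZ) fun a => (a.1.1, a.1.2, a.2)
  have h₂ := entH_comp_le_s9 (μ := μ) (hX.prodMk (hY.prodMk hZ)) fun a => ((a.1, a.2.1), a.2.2)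
  simp only [condI, condH]
  linarith

theorem condI_le_condH_right {X : Ω → α} {Y : Ω → β} {Z : Ω → γ}
    (hX : Measurable X) (hY : Measurable Y) (hZ : Measurable Z) :
    condI μ X Y Z ≤ condH μ Y Z := by
  have h := entH_comp_le_s9 (μ := μ) ((hX.prodMk hY).prodMk hZ) fun a => (a.1.1, a.2)
  simp only [condI, condH]
  linarith

end Entropy

/-- 3-user converse chain (eq:0)–(eq:3): Fano, secrecy and message-independence give
`H(W₁|S)+H(W₂|S)+H(W₃|S) ≤ I(W₁;Y₁|S)+I(W₂;Y₂|Y₁,S)+I(W₃;Y₃|Y₁,Y₂,W₁,S)+6ε`. -/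
theorem stmt_9 {Ω : Type*} [MeasurableSpace Ω] (μ : Measure Ω) [IsProbabilityMeasure μ]
    {α₁ α₂ α₃ β₁ β₂ β₃ σ : Type*}
    [Fintype α₁] [Nonempty α₁] [MeasurableSpace α₁] [MeasurableSingletonClass α₁]
    [Fintype α₂] [Nonempty α₂] [MeasurableSpace α₂] [MeasurableSingletonClass α₂]
    [Fintype α₃] [Nonempty α₃] [MeasurableSpace α₃] [MeasurableSingletonClass α₃]
    [Fintype β₁] [Nonempty β₁] [MeasurableSpace β₁] [MeasurableSingletonClass β₁]
    [Fintype β₂] [Nonempty β₂] [MeasurableSpace β₂] [MeasurableSingletonClass β₂]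
    [Fintype β₃] [Nonempty β₃] [MeasurableSpace β₃] [MeasurableSingletonClass β₃]
    [Fintype σ] [Nonempty σ] [MeasurableSpace σ] [MeasurableSingletonClass σ]
    (W₁ : Ω → α₁) (W₂ : Ω → α₂) (W₃ : Ω → α₃)
    (Y₁ : Ω → β₁) (Y₂ : Ω → β₂) (Y₃ : Ω → β₃) (S : Ω → σ)
    (hW₁ : Measurable W₁) (hW₂ : Measurable W₂) (hW₃ : Measurable W₃)
    (hY₁ : Measurable Y₁) (hY₂ : Measurable Y₂) (hY₃ : Measurable Y₃) (hS : Measurable S)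
    {ε : ℝ} (hε : 0 ≤ ε)
    (hfano₁ : condH μ W₁ (fun ω => (Y₁ ω, S ω)) ≤ ε)
    (hfano₂ : condH μ W₂ (fun ω => (Y₂ ω, S ω)) ≤ ε)
    (hfano₃ : condH μ W₃ (fun ω => (Y₃ ω, S ω)) ≤ ε)
    (hsec₂ : condI μ W₂ Y₁ S ≤ ε)
    (hsec₃ : condI μ W₃ (fun ω => (Y₁ ω, Y₂ ω)) S ≤ ε)
    (hindep : condI μ W₃ W₁ S = 0) :
    condH μ W₁ S + condH μ W₂ S + condH μ W₃ S ≤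
      condI μ W₁ Y₁ S + condI μ W₂ Y₂ (fun ω => (Y₁ ω, S ω)) +
        condI μ W₃ Y₃ (fun ω => (Y₁ ω, Y₂ ω, W₁ ω, S ω)) + 6 * ε := by
  have hV := (hY₁.prodMk hY₂).prodMk hS
  have hY₁S := hY₁.prodMk hS
  have hU := hY₁.prodMk (hY₂.prodMk (hW₁.prodMk hS))
  rw [condI_eq_condH_sub hW₂ hY₁ hS] at hsec₂
  rw [condI_eq_condH_sub hW₃ (hY₁.prodMk hY₂) hS] at hsec₃
  rw [condI_eq_condH_sub hW₁ hY₁ hS, condI_eq_condH_sub hW₂ hY₂ hY₁S,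
    condI_eq_condH_sub hW₃ hY₃ hU]
  have h₂ := condH_le_condH_comp (μ := μ) hW₂ (hY₂.prodMk hY₁S) fun a => (a.1, a.2.2)
  have h₃ := condH_le_condH_comp (μ := μ) hW₃ (hY₃.prodMk hU) fun a => (a.1, a.2.2.2.2)
  have h₁ := condH_le_condH_comp (μ := μ) hW₁ hV fun a => (a.1.1, a.2)
  have hI := condI_le_condH_right (μ := μ) hW₃ hW₁ hV
  rw [condI_eq_condH_sub hW₃ hW₁ hV] at hI
  have hreorder := condH_le_condH_comp (μ := μ) hW₃ (hW₁.prodMk hV)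
    fun a => (a.2.1.1, a.2.1.2, a.1, a.2.2)
  dsimp only at h₁ h₂ h₃ hreorder
  linarith

end Paper
end
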